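/- Shortest-walk semantics Sh is not monotonous: there exist databases D ⊆ D′ and a regular expression R such that Sh(D,R) is not a subset of Sh(D′,R). -/

import Mathlib

namespace RPQ

/-- Vertex identifiers. -/
abbrev V : Type := ℕ
/-- Edge identifiers. -/
abbrev Edg : Type := ℕ
/-- Labels. -/
abbrev Lab : Type := ℕ

/-- A walk: a nonempty alternating sequence `v₀,e₁,v₁,…,e_k,v_k`, encoded as the
initial vertex together with the list of (edge, next-vertex) pairs. -/
structure Walk where
  head : V
  steps : List (Edg × V)
deriving DecidableEq

namespace Walk

def length (w : Walk) : ℕ := w.steps.length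
def src (w : Walk) : V := w.head
def tgt (w : Walk) : V := (w.steps.map Prod.snd).getLastD w.head
/-- The pair of endpoints of a walk. -/
def ep (w : Walk) : V × V := (w.src, w.tgt)
def vertexList (w : Walk) : List V := w.head :: w.steps.map Prod.snd
def edgeList (w : Walk) : List Edg := w.steps.map Prod.fst
/-- Concatenation of walks (meaningful when `w.tgt = w'.src`). -/
def concat (w w' : Walk) : Walk := ⟨w.head, w.steps ++ w'.steps⟩

end Walk

/-- A graph database. -/
structure Database where
  labels : Finset Lab
  verts : Finset V
  edges : Finset Edg
  src : Edg → V
  tgt : Edg → V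
  lbl : Edg → Lab
  src_mem : ∀ e ∈ edges, src e ∈ verts
  tgt_mem : ∀ e ∈ edges, tgt e ∈ verts
  lbl_mem : ∀ e ∈ edges, lbl e ∈ labels

def chainFrom (D : Database) : V → List (Edg × V) → Prop
  | _, [] => True
  | v, (e, v') :: rest =>
      e ∈ D.edges ∧ D.src e = v ∧ D.tgt e = v' ∧ chainFrom D v' rest

/-- `w` is consistent with `D`, i.e. `w` is a walk in `D`. -/
def Walk.Consistent (D : Database) (w : Walk) : Prop :=
  w.head ∈ D.verts ∧ chainFrom D w.head w.steps

/-- The set of walks in `D`. -/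
def Walks (D : Database) : Set Walk := {w | w.Consistent D}

/-- The label of a walk in `D`: the word of its successive edge labels. -/
def Walk.label (D : Database) (w : Walk) : List Lab :=
  w.steps.map fun p => D.lbl p.1

abbrev RE := RegularExpression Lab

/-- Matches of `R` in `D`: walks in `D` whose label conforms to `R`. -/
def Matches (D : Database) (R : RE) : Set Walk :=
  {w | w.Consistent D ∧ w.label D ∈ R.matches'}

/-- A semantics maps a database and a query to a finite subset of its matches. -/
def IsSemantics (S : Database → RE → Set Walk) : Prop :=
  ∀ D R, S D R ⊆ Matches D R ∧ (S D R).Finite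

/-- `S` is walk-based. -/
def WalkBased (S : Database → RE → Set Walk) : Prop :=
  ∃ r : Set Walk → Set Walk, ∀ D R, S D R = r (Matches D R)

/-- The semantics defined by a filter `f`. -/
def FilterSem (f : Walk → Bool) (D : Database) (R : RE) : Set Walk :=
  {w ∈ Matches D R | f w = true}

/-- Componentwise inclusion of databases. -/
def Database.Sub (D D' : Database) : Prop :=
  D.labels ⊆ D'.labels ∧ D.verts ⊆ D'.verts ∧ D.edges ⊆ D'.edges ∧
    ∀ e ∈ D.edges, D'.src e = D.src e ∧ D'.tgt e = D.tgt e ∧ D'.lbl e = D.lbl e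

def IsPartialOrderRel (le : Walk → Walk → Prop) : Prop :=
  (∀ w, le w w) ∧ (∀ a b c, le a b → le b c → le a c) ∧ ∀ a b, le a b → le b a → a = b

/-- `le` is a well-partial-order on the walks of `D`. -/
def IsWpoOn (le : Walk → Walk → Prop) (D : Database) : Prop :=
  ∀ f : ℕ → Walk, (∀ n, (f n).Consistent D) → ∃ i j, i < j ∧ le (f i) (f j)

/-- Suitable order: a partial order on walks that is a wpo on `Walks D` for each `D`. -/
def Suitable (le : Walk → Walk → Prop) : Prop :=
  IsPartialOrderRel le ∧ ∀ D, IsWpoOn le D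

/-- The semantics based on the order `le`: the `le`-minimal matches among those
with the same endpoints. -/
def OrderSem (le : Walk → Walk → Prop) (D : Database) (R : RE) : Set Walk :=
  {w ∈ Matches D R | ∀ w' ∈ Matches D R, w'.ep = w.ep → le w' w → w' = w}

def Monotonous (S : Database → RE → Set Walk) : Prop :=
  ∀ D D' R, D.Sub D' → S D R ⊆ S D' R

def CoMonotonous (S : Database → RE → Set Walk) : Prop :=
  ∀ D D' R, D.Sub D' → S D' R ∩ Walks D ⊆ S D R

def Stabilizing (S : Database → RE → Set Walk) : Prop :=
  ∀ (D : Database) (Rs : ℕ → RE),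
    (∀ i j, i ≤ j → ∀ u, u ∈ (Rs i).matches' → u ∈ (Rs j).matches') →
    ∃ N, ∀ n, N ≤ n → S D (Rs n) = S D (Rs N)

/-- Concatenation lifted to sets of walks. -/
def setConcat (W W' : Set Walk) : Set Walk :=
  {u | ∃ w ∈ W, ∃ w' ∈ W', w.tgt = w'.src ∧ u = w.concat w'}

/-- `setStar W` : all concatenations `w₁·…·w_k` (k ≥ 1) of walks of `W`. -/
inductive setStar (W : Set Walk) : Walk → Prop
  | base : ∀ w ∈ W, setStar W w
  | step : ∀ u w, setStar W u → w ∈ W → u.tgt = w.src → setStar W (u.concat w)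

/-- Walks jointly consistent with some database. -/
def ConsistentPair (w w' : Walk) : Prop :=
  ∃ D : Database, w.Consistent D ∧ w'.Consistent D

/-- The trimming of an order. -/
def trimRel (le : Walk → Walk → Prop) (w w' : Walk) : Prop :=
  ConsistentPair w w' ∧ w.ep = w'.ep ∧ le w w'

def Trimmed (le : Walk → Walk → Prop) : Prop := trimRel le = le

/-- `le` respects element inclusion. -/
def RespectsElemIncl (le : Walk → Walk → Prop) : Prop :=
  ∀ w w', le w w' →
    (∀ v ∈ w.vertexList, v ∈ w'.vertexList) ∧ ∀ e ∈ w.edgeList, e ∈ w'.edgeList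

/-- Action of a relabeling on a database. -/
def Database.relabel (π : Equiv.Perm Lab) (D : Database) : Database where
  labels := D.labels.image (⇑π)
  verts := D.verts
  edges := D.edges
  src := D.src
  tgt := D.tgt
  lbl := fun e => π (D.lbl e)
  src_mem := D.src_mem
  tgt_mem := D.tgt_mem
  lbl_mem := fun e he => Finset.mem_image_of_mem (⇑π) (D.lbl_mem e he)

/-- Action of a renaming on a walk. -/
def Walk.rename (νv : Equiv.Perm V) (νe : Equiv.Perm Edg) (w : Walk) : Walk :=
  ⟨νv w.head, w.steps.map fun p => (νe p.1, νv p.2)⟩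

/-- Action of a renaming on a database. -/
def Database.rename (νv : Equiv.Perm V) (νe : Equiv.Perm Edg) (D : Database) :
    Database where
  labels := D.labels
  verts := D.verts.image (⇑νv)
  edges := D.edges.image (⇑νe)
  src := fun e => νv (D.src (νe.symm e))
  tgt := fun e => νv (D.tgt (νe.symm e))
  lbl := fun e => D.lbl (νe.symm e)
  src_mem := by
    intro e he
    obtain ⟨e', he', rfl⟩ := Finset.mem_image.mp he
    simpa using Finset.mem_image_of_mem (⇑νv) (D.src_mem e' he')
  tgt_mem := by
    intro e he
    obtain ⟨e', he', rfl⟩ := Finset.mem_image.mp he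
    simpa using Finset.mem_image_of_mem (⇑νv) (D.tgt_mem e' he')
  lbl_mem := by
    intro e he
    obtain ⟨e', he', rfl⟩ := Finset.mem_image.mp he
    simpa using D.lbl_mem e' he'

/-- Identifier independence. -/
def IdIndependent (S : Database → RE → Set Walk) : Prop :=
  ∀ (νv : Equiv.Perm V) (νe : Equiv.Perm Edg) (D : Database) (R : RE),
    Walk.rename νv νe '' S D R = S (Database.rename νv νe D) R

/-- Unbounded semantics. -/
def Unbounded (S : Database → RE → Set Walk) : Prop :=
  ∀ n : ℕ, ∃ (D : Database) (R : RE) (w : Walk), w ∈ S D R ∧ n ≤ w.length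

/-- Shortest-walk semantics. -/
def Sh (D : Database) (R : RE) : Set Walk :=
  {w ∈ Matches D R | ∀ w' ∈ Matches D R, w'.ep = w.ep → w.length ≤ w'.length}

/-- The factor-inserting relation `F`. -/
def FactorIns (w w' : Walk) : Prop :=
  ∃ w₁ w₂ w₃ : Walk, w₁.tgt = w₂.src ∧ w₂.tgt = w₃.src ∧ w₁.tgt = w₃.src ∧
    w = w₁.concat w₃ ∧ w' = (w₁.concat w₂).concat w₃

/-- The subwalk order: reflexive–transitive closure of `FactorIns`. -/
def SubwalkOrd : Walk → Walk → Prop := Relation.ReflTransGen FactorIns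

/-- The path `0 → 1 → 2` with edges `0` and `1`, and the shortcut `0 → 2` with edge `2`,
restricted to the edges of `E` and with a single label `0`. -/
def triangle (E : Finset Edg) : Database where
  labels := {0}
  verts := {0, 1, 2}
  edges := E
  src := fun e => if e = 1 then 1 else 0
  tgt := fun e => if e = 0 then 1 else 2
  lbl := fun _ => 0
  src_mem := by intro e _; split_ifs <;> simp
  tgt_mem := by intro e _; split_ifs <;> simp
  lbl_mem := by simp

lemma triangle_sub {E E' : Finset Edg} (h : E ⊆ E') : (triangle E).Sub (triangle E') :=
  ⟨Finset.Subset.refl _, Finset.Subset.refl _, h, fun _ _ => ⟨rfl, rfl, rfl⟩⟩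

/-- The query `a + aa` for the label `a = 0`. -/
def oneOrTwo : RE :=
  RegularExpression.char 0 + RegularExpression.char 0 * RegularExpression.char 0

lemma singleton_mem_oneOrTwo : [0] ∈ oneOrTwo.matches' := by
  rw [oneOrTwo, RegularExpression.matches'_add, Language.mem_add]
  exact Or.inl rfl

lemma pair_mem_oneOrTwo : [0, 0] ∈ oneOrTwo.matches' := by
  rw [oneOrTwo, RegularExpression.matches'_add, Language.mem_add]
  exact Or.inr (Language.append_mem_mul (a := [0]) (b := [0]) rfl rfl)

lemma two_le_length_of_triangle {w : Walk} (hw : w.Consistent (triangle {0, 1}))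
    (hep : w.ep = (0, 2)) : 2 ≤ w.length := by
  obtain ⟨v, _ | ⟨⟨e, u⟩, _ | ⟨p, l⟩⟩⟩ := w
  · simp [Walk.ep, Walk.src, Walk.tgt] at hep
    lia
  · simp [Walk.ep, Walk.src, Walk.tgt] at hep
    obtain ⟨rfl, rfl⟩ := hep
    obtain ⟨-, he, hsrc, htgt, -⟩ := hw
    simp [triangle] at he hsrc htgt
    lia
  · simp [Walk.length]

/-- Shortest-walk semantics is not monotonous. -/
theorem Sh_not_monotonous :
    ∃ (D D' : Database) (R : RE), D.Sub D' ∧ ¬ Sh D R ⊆ Sh D' R := by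
  refine ⟨triangle {0, 1}, triangle {0, 1, 2}, oneOrTwo, triangle_sub (by decide), fun h => ?_⟩
  have hpath : (⟨0, [(0, 1), (1, 2)]⟩ : Walk) ∈ Sh (triangle {0, 1}) oneOrTwo := by
    refine ⟨⟨?_, pair_mem_oneOrTwo⟩, fun w hw hep => two_le_length_of_triangle hw.1 hep⟩
    simp [Walk.Consistent, chainFrom, triangle]
  have hshortcut : (⟨0, [(2, 2)]⟩ : Walk) ∈ Matches (triangle {0, 1, 2}) oneOrTwo := by
    refine ⟨?_, singleton_mem_oneOrTwo⟩
    simp [Walk.Consistent, chainFrom, triangle]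
  exact absurd ((h hpath).2 _ hshortcut rfl) (by decide)

end RPQ
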